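/- arXiv:2310.00726 — 7 statements merged into one kernel-verified Lean document; each statement's English description precedes it below -/
import Mathlib

section
/- Let ι be a finite nonempty index set, τ ≥ 0, and A : ι → ℝ. Let M = max_{j∈ι} A_j and let S = {j ∈ ι : A_j = M} be the set of maximizers. Suppose there is γ > 0 such that A_j ≤ M − γ for every j ∉ S. Then the total tempered softmax mass on the maximizers satisfies Σ_{j∈S} smax_τ(A)_j ≥ 1 − |ι|·exp(−τ·γ). -/
/-- Tempered softmax concentration: if all non-maximizers of `A` are at least `γ`
below the maximum `M`, then the tempered softmax mass on the set `S` of maximizers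
is at least `1 - |ι| · exp (-τγ)`. -/
theorem tempered_softmax_concentration
    {ι : Type*} [Fintype ι] [Nonempty ι] (τ : ℝ) (hτ : 0 ≤ τ) (A : ι → ℝ)
    (M : ℝ) (hM : M = Finset.univ.sup' Finset.univ_nonempty A)
    (S : Finset ι) (hS : S = Finset.univ.filter (fun j => A j = M))
    (γ : ℝ) (hγ : 0 < γ) (hgap : ∀ j ∉ S, A j ≤ M - γ) :
    1 - (Fintype.card ι : ℝ) * Real.exp (-(τ * γ)) ≤
      ∑ j ∈ S, Real.exp (τ * A j) / ∑ j' : ι, Real.exp (τ * A j') := by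
  classical
  set Z := ∑ j' : ι, Real.exp (τ * A j') with hZ
  have hZpos : 0 < Z := Finset.sum_pos (fun j _ => Real.exp_pos _) Finset.univ_nonempty
  have hMZ : Real.exp (τ * M) ≤ Z := by
    obtain ⟨i, hi, hAi⟩ := Finset.exists_mem_eq_sup' Finset.univ_nonempty A
    rw [hM, hAi]
    exact Finset.single_le_sum (f := fun j => Real.exp (τ * A j))
      (fun j _ => (Real.exp_pos _).le) hi
  have htotal : ∑ j, Real.exp (τ * A j) / Z = 1 := by
    rw [← Finset.sum_div, ← hZ, div_self hZpos.ne']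
  have hweight : ∀ j ∈ Sᶜ, Real.exp (τ * A j) / Z ≤ Real.exp (-(τ * γ)) := by
    intro j hj
    rw [div_le_iff₀ hZpos]
    calc Real.exp (τ * A j) ≤ Real.exp (τ * (M - γ)) := by
          gcongr
          exact hgap j (Finset.mem_compl.mp hj)
      _ = Real.exp (-(τ * γ)) * Real.exp (τ * M) := by
          rw [← Real.exp_add]
          ring_nf
      _ ≤ Real.exp (-(τ * γ)) * Z := by gcongr
  have hcompl : ∑ j ∈ Sᶜ, Real.exp (τ * A j) / Z ≤ Fintype.card ι * Real.exp (-(τ * γ)) := by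
    calc ∑ j ∈ Sᶜ, Real.exp (τ * A j) / Z ≤ (Sᶜ).card * Real.exp (-(τ * γ)) := by
          simpa using Finset.sum_le_card_nsmul _ _ _ hweight
      _ ≤ Fintype.card ι * Real.exp (-(τ * γ)) := by
          gcongr
          exact Finset.card_le_univ _
  have hsplit := Finset.sum_add_sum_compl S (fun j => Real.exp (τ * A j) / Z)
  linarith
end

section
/- Let q ≥ 1 and n ≥ 1 be natural numbers, and let c : {1,…,q} → ℕ satisfy c_b ≤ n for every b and c_b ≥ 1 for at least one b. For b ∈ {1,…,q} set α_b = n^{3(q−b+1)}, and let b* be the least b with c_b ≥ 1. Then (α_{b*}·c_{b*}) / (1 + Σ_{b=1}^{q} α_b·c_b) ≥ 1 − (q+1)/n². -/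
/-- Noisy min operation: with weights `α_b = n^{3(q-b+1)}` and counts `c_b ≤ n`,
the least symbol `b*` with `c_{b*} ≥ 1` receives attention mass at least
`1 - (q+1)/n²` (the `1` in the denominator is the delimiter's self-weight). -/
theorem min_attention_mass (q n : ℕ) (hq : 1 ≤ q) (hn : 1 ≤ n)
    (c : ℕ → ℕ) (hc : ∀ b ∈ Finset.Icc 1 q, c b ≤ n)
    (bstar : ℕ) (hb1 : bstar ∈ Finset.Icc 1 q) (hb2 : 1 ≤ c bstar)
    (hbmin : ∀ b ∈ Finset.Icc 1 q, 1 ≤ c b → bstar ≤ b) :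
    1 - ((q : ℝ) + 1) / (n : ℝ) ^ 2 ≤
      ((n : ℝ) ^ (3 * (q - bstar + 1)) * (c bstar : ℝ)) /
        (1 + ∑ b ∈ Finset.Icc 1 q, (n : ℝ) ^ (3 * (q - b + 1)) * (c b : ℝ)) := by
  have hn' : (1 : ℝ) ≤ n := by exact_mod_cast hn
  have hn2 : (0 : ℝ) < (n : ℝ) ^ 2 := by positivity
  set f : ℕ → ℝ := fun b => (n : ℝ) ^ (3 * (q - b + 1)) * (c b : ℝ) with hf
  set M : ℝ := (n : ℝ) ^ (3 * (q - bstar)) * n with hM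
  have hM1 : 1 ≤ M := one_le_mul_of_one_le_of_one_le (one_le_pow₀ hn') hn'
  have hMT : M * (n : ℝ) ^ 2 ≤ f bstar := by
    have hc1 : (1 : ℝ) ≤ c bstar := by exact_mod_cast hb2
    calc M * (n : ℝ) ^ 2 = (n : ℝ) ^ (3 * (q - bstar + 1)) := by rw [hM]; ring
      _ ≤ f bstar := le_mul_of_one_le_right (by positivity) hc1
  have hterm : ∀ b ∈ (Finset.Icc 1 q).erase bstar, f b ≤ M := by
    intro b hb
    obtain ⟨hne, hbq⟩ := Finset.mem_erase.1 hb
    rcases Nat.eq_zero_or_pos (c b) with h0 | hpos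
    · simp only [hf, h0, Nat.cast_zero, mul_zero]
      positivity
    · have hle := hbmin b hbq hpos
      have hbIcc := Finset.mem_Icc.1 hbq
      have hcn : (c b : ℝ) ≤ n := by exact_mod_cast hc b hbq
      exact mul_le_mul (pow_le_pow_right₀ hn' (by omega)) hcn (by positivity) (by positivity)
  have hrest : ∑ b ∈ (Finset.Icc 1 q).erase bstar, f b ≤ q * M := by
    calc ∑ b ∈ (Finset.Icc 1 q).erase bstar, f b
        ≤ ((Finset.Icc 1 q).erase bstar).card • M := Finset.sum_le_card_nsmul _ _ _ hterm
      _ ≤ q * M := by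
        rw [nsmul_eq_mul]
        have hcard : ((Finset.Icc 1 q).erase bstar).card ≤ q := by
          simpa using Finset.card_erase_le (s := Finset.Icc 1 q) (a := bstar)
        gcongr
  have hrest0 : 0 ≤ ∑ b ∈ (Finset.Icc 1 q).erase bstar, f b :=
    Finset.sum_nonneg fun b _ => by positivity
  change 1 - ((q : ℝ) + 1) / (n : ℝ) ^ 2 ≤ f bstar / (1 + ∑ b ∈ Finset.Icc 1 q, f b)
  rw [← Finset.add_sum_erase _ f hb1]
  set R := ∑ b ∈ (Finset.Icc 1 q).erase bstar, f b
  have hT : 0 ≤ f bstar := by positivity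
  have hD : 0 < 1 + (f bstar + R) := by positivity
  rw [sub_le_iff_le_add, div_add_div _ _ hD.ne' hn2.ne', one_le_div (by positivity)]
  have hR : (1 + R) * (n : ℝ) ^ 2 ≤ (q + 1) * f bstar := by
    calc (1 + R) * (n : ℝ) ^ 2 ≤ ((q + 1) * M) * (n : ℝ) ^ 2 := by
          gcongr
          linarith
      _ = (q + 1) * (M * (n : ℝ) ^ 2) := by ring
      _ ≤ (q + 1) * f bstar := by gcongr
  have hqR : 0 ≤ (1 + R) * ((q : ℝ) + 1) := by positivity
  linarith
end

section
/- Let q ≥ 1 and n ≥ 1 be natural numbers, let a ∈ {1,…,q}, and let c : {1,…,q} → ℕ satisfy c_b ≤ 2n for every b and c_b ≥ 1 for at least one b > a. Let b* be the least b > a with c_b ≥ 1. Define weights w_b = n^{3(q−b+1)} for b > a and w_b = 1 for b ≤ a. Then (w_{b*}·c_{b*}) / (Σ_{b=1}^{q} w_b·c_b) ≥ 1 − 4q/n². -/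
/-- If every term of a nonnegative family is at most `ε` times a distinguished positive term,
then that term carries at least the fraction `1 - #s * ε` of the total. -/
lemma one_sub_card_mul_le_div_sum {ι : Type*} [DecidableEq ι] (s : Finset ι) (f : ι → ℝ)
    {i : ι} (hi : i ∈ s) (hf : ∀ j ∈ s, 0 ≤ f j) (hpos : 0 < f i) {ε : ℝ} (hε : 0 ≤ ε)
    (h : ∀ j ∈ s, j ≠ i → f j ≤ ε * f i) :
    1 - s.card * ε ≤ f i / ∑ j ∈ s, f j := by
  have hle : f i ≤ ∑ j ∈ s, f j := Finset.single_le_sum hf hi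
  rw [le_div_iff₀ (hpos.trans_le hle)]
  have hrest : ∑ j ∈ s.erase i, f j ≤ s.card * ε * f i :=
    calc ∑ j ∈ s.erase i, f j ≤ ∑ _j ∈ s.erase i, ε * f i :=
          Finset.sum_le_sum fun j hj => h j (Finset.mem_of_mem_erase hj) (Finset.ne_of_mem_erase hj)
      _ = (s.erase i).card * (ε * f i) := by rw [Finset.sum_const, nsmul_eq_mul]
      _ ≤ s.card * (ε * f i) := by
          gcongr
          exact Finset.erase_subset i s
      _ = s.card * ε * f i := by ring
  have hsplit := Finset.add_sum_erase s f hi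
  have hmono : s.card * ε * f i ≤ s.card * ε * ∑ j ∈ s, f j := by gcongr
  linarith

/-- Noisy successor operation: with weights `w_b = n^{3(q-b+1)}` for `b > a` and
`w_b = 1` for `b ≤ a`, and counts `c_b ≤ 2n`, the least symbol `b* > a` with
`c_{b*} ≥ 1` receives attention mass at least `1 - 4q/n²`. -/
theorem successor_attention_mass (q n : ℕ) (hq : 1 ≤ q) (hn : 1 ≤ n)
    (a : ℕ) (ha : a ∈ Finset.Icc 1 q)
    (c : ℕ → ℕ) (hc : ∀ b ∈ Finset.Icc 1 q, c b ≤ 2 * n)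
    (bstar : ℕ) (hb1 : bstar ∈ Finset.Icc 1 q) (hba : a < bstar) (hb2 : 1 ≤ c bstar)
    (hbmin : ∀ b ∈ Finset.Icc 1 q, a < b → 1 ≤ c b → bstar ≤ b) :
    1 - 4 * (q : ℝ) / (n : ℝ) ^ 2 ≤
      ((if a < bstar then (n : ℝ) ^ (3 * (q - bstar + 1)) else 1) * (c bstar : ℝ)) /
        (∑ b ∈ Finset.Icc 1 q,
          (if a < b then (n : ℝ) ^ (3 * (q - b + 1)) else 1) * (c b : ℝ)) := by
  have hn' : (1 : ℝ) ≤ n := by exact_mod_cast hn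
  have hn0 : (0 : ℝ) < n := by linarith
  have hc1 : (1 : ℝ) ≤ c bstar := by exact_mod_cast hb2
  have key := one_sub_card_mul_le_div_sum (Finset.Icc 1 q)
    (fun b => (if a < b then (n : ℝ) ^ (3 * (q - b + 1)) else 1) * (c b : ℝ)) hb1
    (fun b _ => by positivity) (by simp only [if_pos hba]; positivity)
    (ε := 2 / (n : ℝ) ^ 2) (by positivity) (by
      intro b hb hne
      have hcb : (c b : ℝ) ≤ 2 * n := by exact_mod_cast hc b hb
      simp only [if_pos hba]
      rw [div_mul_eq_mul_div, le_div_iff₀ (by positivity)]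
      have hmass : (n : ℝ) ^ (3 * (q - bstar + 1)) ≤
          (n : ℝ) ^ (3 * (q - bstar + 1)) * c bstar :=
        le_mul_of_one_le_right (by positivity) hc1
      have bound : ∀ k : ℕ, k + 3 ≤ 3 * (q - bstar + 1) →
          (n : ℝ) ^ k * c b * (n : ℝ) ^ 2 ≤
            2 * ((n : ℝ) ^ (3 * (q - bstar + 1)) * c bstar) := fun k hk =>
        calc (n : ℝ) ^ k * c b * (n : ℝ) ^ 2 ≤ (n : ℝ) ^ k * (2 * n) * (n : ℝ) ^ 2 := by gcongr
          _ = 2 * (n : ℝ) ^ (k + 3) := by ring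
          _ ≤ 2 * (n : ℝ) ^ (3 * (q - bstar + 1)) := by gcongr
          _ ≤ _ := by gcongr
      split_ifs with hab
      · rcases Nat.eq_zero_or_pos (c b) with h0 | h0
        · rw [h0]
          simp only [Nat.cast_zero, mul_zero, zero_mul]
          positivity
        · have hlt := hbmin b hb hab h0
          rw [Finset.mem_Icc] at hb hb1
          exact bound _ (by omega)
      · simpa using bound 0 (by omega))
  refine le_trans ?_ key
  rw [Nat.card_Icc, Nat.add_sub_cancel, mul_div_assoc', sub_le_sub_iff_left]
  gcongr ?_ / _
  have hq0 : (0 : ℝ) ≤ q := q.cast_nonneg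
  linarith
end

section
/- Let E be a real normed vector space, n ≥ 1 a natural number, and ι a finite index set partitioned into sets S₁, S₂, R with |S₁| = k₁, |S₂| = k₂, k₁ + k₂ ≥ 1, and |R| = m ≤ n. Define D = (k₁ + k₂)·n³ + m and weights p_j = n³/D for j ∈ S₁ ∪ S₂ and p_j = 1/D for j ∈ R. Let v ∈ E with ‖v‖ ≤ 1, and let v_j = v for j ∈ S₁, v_j = −v for j ∈ S₂, and ‖v_j‖ ≤ 1 for j ∈ R. Then ‖Σ_{j∈ι} p_j·v_j − ((k₁ − k₂)/(k₁ + k₂))·v‖ ≤ 2/n². -/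
/-- Identity+Successor mechanism: attention with weight `n³/D` on `S₁` (value `v`) and
on `S₂` (value `-v`), and weight `1/D` on the `m ≤ n` remaining positions, where
`D = (k₁+k₂)n³ + m`, outputs the signed discrepancy `((k₁-k₂)/(k₁+k₂)) • v`
up to an error of norm `2/n²`. -/
theorem signed_discrepancy_attention
    {E : Type*} [NormedAddCommGroup E] [NormedSpace ℝ E]
    {ι : Type*} [Fintype ι] [DecidableEq ι] (n : ℕ) (hn : 1 ≤ n)
    (S₁ S₂ R : Finset ι)
    (hd12 : Disjoint S₁ S₂) (hd1R : Disjoint S₁ R) (hd2R : Disjoint S₂ R)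
    (hcover : S₁ ∪ S₂ ∪ R = Finset.univ)
    (k₁ k₂ m : ℕ) (hk₁ : S₁.card = k₁) (hk₂ : S₂.card = k₂)
    (hk : 1 ≤ k₁ + k₂) (hm : R.card = m) (hmn : m ≤ n)
    (p : ι → ℝ)
    (hpS : ∀ j ∈ S₁ ∪ S₂,
      p j = (n : ℝ) ^ 3 / (((k₁ : ℝ) + (k₂ : ℝ)) * (n : ℝ) ^ 3 + (m : ℝ)))
    (hpR : ∀ j ∈ R, p j = 1 / (((k₁ : ℝ) + (k₂ : ℝ)) * (n : ℝ) ^ 3 + (m : ℝ)))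
    (v : E) (hv : ‖v‖ ≤ 1) (w : ι → E)
    (hw1 : ∀ j ∈ S₁, w j = v) (hw2 : ∀ j ∈ S₂, w j = -v)
    (hwR : ∀ j ∈ R, ‖w j‖ ≤ 1) :
    ‖(∑ j, p j • w j) - (((k₁ : ℝ) - (k₂ : ℝ)) / ((k₁ : ℝ) + (k₂ : ℝ))) • v‖ ≤
      2 / (n : ℝ) ^ 2 := by
  set K : ℝ := (k₁ : ℝ) + (k₂ : ℝ) with hK
  set D : ℝ := K * (n : ℝ) ^ 3 + (m : ℝ) with hD
  have hn0 : (0 : ℝ) < n := by exact_mod_cast hn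
  have hK1 : (1 : ℝ) ≤ K := by rw [hK]; exact_mod_cast hk
  have hK0 : 0 < K := by linarith
  have hm0 : (0 : ℝ) ≤ m := m.cast_nonneg
  have hD0 : 0 < D := by positivity
  have hsum : ∑ j, p j • w j
      = ((n : ℝ) ^ 3 / D * (k₁ - k₂)) • v + ∑ j ∈ R, p j • w j := by
    have h1 : ∑ j ∈ S₁, p j • w j = ((k₁ : ℝ) * ((n : ℝ) ^ 3 / D)) • v := by
      rw [Finset.sum_congr rfl fun j hj => by
        rw [hpS j (Finset.mem_union_left _ hj), hw1 j hj], Finset.sum_const, hk₁,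
        ← Nat.cast_smul_eq_nsmul ℝ, smul_smul]
    have h2 : ∑ j ∈ S₂, p j • w j = -(((k₂ : ℝ) * ((n : ℝ) ^ 3 / D)) • v) := by
      rw [Finset.sum_congr rfl fun j hj => by
        rw [hpS j (Finset.mem_union_right _ hj), hw2 j hj], Finset.sum_const, hk₂,
        ← Nat.cast_smul_eq_nsmul ℝ, smul_smul, smul_neg]
    rw [← hcover, Finset.sum_union (Finset.disjoint_union_left.2 ⟨hd1R, hd2R⟩),
      Finset.sum_union hd12, h1, h2]
    module
  have hrest : ‖∑ j ∈ R, p j • w j‖ ≤ m / D := by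
    refine (norm_sum_le_of_le R (n := fun _ => 1 / D) fun j hj => ?_).trans_eq ?_
    · rw [hpR j hj, norm_smul, Real.norm_of_nonneg (by positivity)]
      exact mul_le_of_le_one_right (by positivity) (hwR j hj)
    · rw [Finset.sum_const, hm, nsmul_eq_mul, mul_one_div]
  have hcoeff : |(n : ℝ) ^ 3 / D * (k₁ - k₂) - (k₁ - k₂) / K| ≤ m / D := by
    have heq : (n : ℝ) ^ 3 / D * (k₁ - k₂) - (k₁ - k₂) / K
        = -((k₁ - k₂) / K * (m / D)) := by
      field_simp
      rw [hD]
      ring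
    have hratio : |((k₁ : ℝ) - k₂) / K| ≤ 1 := by
      rw [abs_div, abs_of_pos hK0, div_le_one hK0, abs_le]
      constructor <;> linarith [k₁.cast_nonneg (α := ℝ), k₂.cast_nonneg (α := ℝ)]
    rw [heq, abs_neg, abs_mul, abs_of_nonneg (show 0 ≤ (m : ℝ) / D by positivity)]
    exact mul_le_of_le_one_left (by positivity) hratio
  have hbound : (m : ℝ) / D ≤ 1 / (n : ℝ) ^ 2 := by
    have hmn' : (m : ℝ) ≤ n := by exact_mod_cast hmn
    rw [div_le_div_iff₀ hD0 (by positivity)]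
    calc (m : ℝ) * n ^ 2 ≤ n * n ^ 2 := by gcongr
      _ = 1 * (n : ℝ) ^ 3 := by ring
      _ ≤ K * (n : ℝ) ^ 3 := by gcongr
      _ ≤ 1 * D := by linarith
  rw [hsum, add_sub_right_comm, ← sub_smul]
  calc _ ≤ ‖((n : ℝ) ^ 3 / D * (k₁ - k₂) - (k₁ - k₂) / K) • v‖ + ‖∑ j ∈ R, p j • w j‖ :=
        norm_add_le _ _
    _ ≤ m / D + m / D := by
        gcongr
        rw [norm_smul, Real.norm_eq_abs]
        exact (mul_le_of_le_one_right (abs_nonneg _) hv).trans hcoeff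
    _ ≤ 1 / (n : ℝ) ^ 2 + 1 / (n : ℝ) ^ 2 := by gcongr
    _ = 2 / (n : ℝ) ^ 2 := by ring
end

section
/- Let E be a real inner product space, Σ a finite set, and w, w' : Σ → E functions such that the combined family {w_b}_{b∈Σ} ∪ {w'_b}_{b∈Σ} is orthonormal. Let a ∈ Σ, c > 0, ε ≥ 0, β : Σ → ℝ with 0 ≤ β_b ≤ 1 for all b, and u ∈ E, and set x = c·w_a + ε·Σ_{b∈Σ} β_b·w'_b + u. If c > ε + 4‖u‖, then for every b ≠ a one has ⟨x, w_b + w'_b⟩ < ⟨x, w_a + w'_a⟩; in other words a is the unique maximizer of b ↦ ⟨x, w_b + w'_b⟩. -/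
open scoped RealInnerProductSpace

/-- The score of `b` against `c • w a + ε • ∑ d, β d • w' d + u`, for an orthonormal family
`Sum.elim w w'`. -/
theorem Orthonormal.inner_sumElim_score
    {E : Type*} [NormedAddCommGroup E] [InnerProductSpace ℝ E]
    {σ : Type*} [Fintype σ] [DecidableEq σ] {w w' : σ → E}
    (h : Orthonormal ℝ (Sum.elim w w')) (a b : σ) (c ε : ℝ) (β : σ → ℝ) (u : E) :
    ⟪c • w a + ε • (∑ d, β d • w' d) + u, w b + w' b⟫ =
      (if a = b then c else 0) + ε * β b + ⟪u, w b + w' b⟫ := by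
  have hww (i j : σ) : ⟪w i, w j⟫ = if i = j then (1 : ℝ) else 0 := by
    simpa using orthonormal_iff_ite.mp h (Sum.inl i) (Sum.inl j)
  have hww' (i j : σ) : ⟪w i, w' j⟫ = 0 := by
    simpa using orthonormal_iff_ite.mp h (Sum.inl i) (Sum.inr j)
  have hw'w (i j : σ) : ⟪w' i, w j⟫ = 0 := by
    simpa using orthonormal_iff_ite.mp h (Sum.inr i) (Sum.inl j)
  have hw'w' (i j : σ) : ⟪w' i, w' j⟫ = if i = j then (1 : ℝ) else 0 := by
    simpa using orthonormal_iff_ite.mp h (Sum.inr i) (Sum.inr j)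
  simp [inner_add_left, inner_add_right, inner_smul_left, sum_inner, hww, hww', hw'w, hw'w']
  ring

/-- Inner products with `w b + w' b` are at most `2 * ‖u‖` in absolute value. -/
theorem Orthonormal.abs_inner_sumElim_add_le
    {E : Type*} [NormedAddCommGroup E] [InnerProductSpace ℝ E] {σ : Type*} {w w' : σ → E}
    (h : Orthonormal ℝ (Sum.elim w w')) (b : σ) (u : E) :
    |⟪u, w b + w' b⟫| ≤ 2 * ‖u‖ := by
  have hw : ‖w b‖ = 1 := h.norm_eq_one (Sum.inl b)
  have hw' : ‖w' b‖ = 1 := h.norm_eq_one (Sum.inr b)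
  calc |⟪u, w b + w' b⟫| ≤ ‖u‖ * ‖w b + w' b‖ := abs_real_inner_le_norm _ _
    _ ≤ ‖u‖ * (‖w b‖ + ‖w' b‖) := by gcongr; exact norm_add_le _ _
    _ = 2 * ‖u‖ := by rw [hw, hw']; ring

/-- Decoding the duplicate case: if `x = c • w_a + ε • Σ_b β_b • w'_b + u` with the
combined family `{w_b} ∪ {w'_b}` orthonormal, `0 ≤ β_b ≤ 1`, and `c > ε + 4‖u‖`,
then `a` is the unique maximizer of `b ↦ ⟪x, w_b + w'_b⟫`. -/
theorem decode_duplicate_case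
    {E : Type*} [NormedAddCommGroup E] [InnerProductSpace ℝ E]
    {σ : Type*} [Fintype σ] (w w' : σ → E)
    (hortho : Orthonormal ℝ (Sum.elim w w' : σ ⊕ σ → E))
    (a : σ) (c ε : ℝ) (hc : 0 < c) (hε : 0 ≤ ε)
    (β : σ → ℝ) (hβ0 : ∀ b, 0 ≤ β b) (hβ1 : ∀ b, β b ≤ 1)
    (u x : E) (hx : x = c • w a + ε • (∑ b, β b • w' b) + u)
    (hgap : ε + 4 * ‖u‖ < c) :
    ∀ b ≠ a, ⟪x, w b + w' b⟫ < ⟪x, w a + w' a⟫ := by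
  classical
  intro b hb
  rw [hx, hortho.inner_sumElim_score, hortho.inner_sumElim_score, if_neg hb.symm, if_pos rfl]
  have hub := (abs_le.mp (hortho.abs_inner_sumElim_add_le b u)).2
  have hua := (abs_le.mp (hortho.abs_inner_sumElim_add_le a u)).1
  have hβb : ε * β b ≤ ε := mul_le_of_le_one_right hε (hβ1 b)
  have hβa : 0 ≤ ε * β a := mul_nonneg hε (hβ0 a)
  linarith
end

section
/- Let E be a real inner product space, Σ a finite set, and w, w' : Σ → E functions such that the combined family {w_b}_{b∈Σ} ∪ {w'_b}_{b∈Σ} is orthonormal. Let s ∈ Σ, ε > 0, 0 ≤ η < 1/2, β : Σ → ℝ with β_b ≥ 0 for all b, Σ_{b∈Σ} β_b ≤ 1, and β_s ≥ 1 − η, and let u ∈ E. Set x = ε·Σ_{b∈Σ} β_b·w'_b + u. If ε·(1 − 2η) > 4‖u‖, then for every b ≠ s one has ⟨x, w_b + w'_b⟩ < ⟨x, w_s + w'_s⟩; in other words s is the unique maximizer of b ↦ ⟨x, w_b + w'_b⟩. -/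
open scoped RealInnerProductSpace

/-- Against a combination of `w'` plus an error `u`, the score of `b` is its weight up to the
contribution of `u`. -/
theorem inner_combination_add_score
    {E : Type*} [NormedAddCommGroup E] [InnerProductSpace ℝ E]
    {σ : Type*} [Fintype σ] {w w' : σ → E}
    (hortho : Orthonormal ℝ (Sum.elim w w' : σ ⊕ σ → E))
    (ε : ℝ) (β : σ → ℝ) (u : E) (b : σ) :
    ⟪ε • (∑ a, β a • w' a) + u, w b + w' b⟫ = ε * β b + ⟪u, w b + w' b⟫ := by
  have hw' : Orthonormal ℝ w' := hortho.comp Sum.inr Sum.inr_injective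
  have hcross (a : σ) : ⟪w' a, w b⟫ = 0 :=
    hortho.inner_eq_zero (i := Sum.inr a) (j := Sum.inl b) Sum.inr_ne_inl
  have hsum : ⟪∑ a, β a • w' a, w b⟫ = 0 := by
    simp [sum_inner, real_inner_smul_left, hcross]
  have hsum' : ⟪∑ a, β a • w' a, w' b⟫ = β b := by
    simpa using hw'.inner_left_fintype β b
  rw [inner_add_left, real_inner_smul_left, inner_add_right (∑ a, β a • w' a), hsum, hsum',
    zero_add]

/-- A vector `u` contributes at most `2 * ‖u‖` to the score of any symbol. -/
theorem abs_inner_score_le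
    {E : Type*} [NormedAddCommGroup E] [InnerProductSpace ℝ E]
    {σ : Type*} {w w' : σ → E}
    (hortho : Orthonormal ℝ (Sum.elim w w' : σ ⊕ σ → E)) (u : E) (b : σ) :
    |⟪u, w b + w' b⟫| ≤ 2 * ‖u‖ := by
  have hw : ‖w b‖ = 1 := hortho.norm_eq_one (Sum.inl b)
  have hw' : ‖w' b‖ = 1 := hortho.norm_eq_one (Sum.inr b)
  calc |⟪u, w b + w' b⟫| ≤ ‖u‖ * ‖w b + w' b‖ := abs_real_inner_le_norm _ _
    _ ≤ ‖u‖ * (‖w b‖ + ‖w' b‖) := by gcongr; exact norm_add_le _ _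
    _ = 2 * ‖u‖ := by rw [hw, hw']; ring

/-- Decoding the successor case: if `x = ε • Σ_b β_b • w'_b + u` with the combined
family `{w_b} ∪ {w'_b}` orthonormal, `β` a subconvex weight vector placing mass at
least `1 - η` on `s` (with `0 ≤ η < 1/2`), and `ε(1 - 2η) > 4‖u‖`, then `s` is the
unique maximizer of `b ↦ ⟪x, w_b + w'_b⟫`. -/
theorem decode_successor_case
    {E : Type*} [NormedAddCommGroup E] [InnerProductSpace ℝ E]
    {σ : Type*} [Fintype σ] (w w' : σ → E)
    (hortho : Orthonormal ℝ (Sum.elim w w' : σ ⊕ σ → E))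
    (s : σ) (ε η : ℝ) (hε : 0 < ε) (hη0 : 0 ≤ η) (hη : η < 1 / 2)
    (β : σ → ℝ) (hβ0 : ∀ b, 0 ≤ β b) (hβsum : ∑ b, β b ≤ 1) (hβs : 1 - η ≤ β s)
    (u x : E) (hx : x = ε • (∑ b, β b • w' b) + u)
    (hgap : 4 * ‖u‖ < ε * (1 - 2 * η)) :
    ∀ b ≠ s, ⟪x, w b + w' b⟫ < ⟪x, w s + w' s⟫ := by
  intro b hb
  have hpair : β b + β s ≤ ∑ a, β a :=
    Finset.add_le_sum (fun a _ => hβ0 a) (Finset.mem_univ b) (Finset.mem_univ s) hb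
  have hweights : ε * (1 - 2 * η) ≤ ε * (β s - β b) :=
    mul_le_mul_of_nonneg_left (by linarith) hε.le
  have hub := (abs_le.mp (abs_inner_score_le hortho u b)).2
  have hus := (abs_le.mp (abs_inner_score_le hortho u s)).1
  rw [hx, inner_combination_add_score hortho, inner_combination_add_score hortho]
  linarith
end

section
/- Let E be a real inner product space, Σ a finite set with |Σ| = q, and let {e_b}_{b∈Σ} ∪ {t} ∪ {f_b}_{b∈Σ} ∪ {g} be an orthonormal family in E. Define F : E → E by F(x) = Σ_{b∈Σ} max(0, ⟨x, e_b⟩ + ⟨x, t⟩ − 1)·(−f_b − g). Fix a ∈ Σ, 0 ≤ δ ≤ 1/4, and u ∈ E with |⟨u, e_b⟩| ≤ δ for all b ∈ Σ and |⟨u, t⟩| ≤ δ. Then for x = e_a + t + u one has ‖F(x) − (−f_a − g)‖ ≤ 3qδ. -/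
open scoped RealInnerProductSpace

/-- Two orthogonal unit vectors `v`, `w` satisfy `‖-v - w‖ = √2 ≤ 3 / 2`. -/
theorem norm_neg_sub_le_of_orthogonal_unit {E : Type*} [NormedAddCommGroup E]
    [InnerProductSpace ℝ E] {v w : E} (hv : ‖v‖ = 1) (hw : ‖w‖ = 1) (hvw : ⟪v, w⟫ = 0) :
    ‖-v - w‖ ≤ 3 / 2 := by
  have h := norm_sub_sq_real (-v) w
  rw [inner_neg_left, hvw, norm_neg, hv, hw] at h
  nlinarith [norm_nonneg (-v - w)]

/-- Perturbing a nonnegative ReLU input by two terms of size at most `δ` changes the output by at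
most `2 * δ`. -/
theorem abs_relu_sub_le {y s r δ : ℝ} (hy : 0 ≤ y) (hs : |s| ≤ δ) (hr : |r| ≤ δ) :
    |max 0 (y + s + r) - y| ≤ 2 * δ := by
  have h := abs_max_sub_max_le_abs (y + s + r) y 0
  rw [max_comm _ 0, max_eq_left hy, add_assoc, add_sub_cancel_left] at h
  rw [add_assoc]
  linarith [abs_add_le s r]

/-- The first MLP layer: with `{e_b} ∪ {t} ∪ {f_b} ∪ {g}` orthonormal and
`F x = Σ_b ReLU(⟪x, e_b⟫ + ⟪x, t⟫ - 1) • (-f_b - g)`, on the noisy embedding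
`x = e_a + t + u` (with `|⟪u, e_b⟫| ≤ δ`, `|⟪u, t⟫| ≤ δ`, `δ ≤ 1/4`) the layer
computes `-f_a - g` up to error `3qδ`. -/
theorem mlp_denoiser
    {E : Type*} [NormedAddCommGroup E] [InnerProductSpace ℝ E]
    {σ : Type*} [Fintype σ] (q : ℕ) (hq : Fintype.card σ = q)
    (e : σ → E) (t : E) (f : σ → E) (g : E)
    (hortho : Orthonormal ℝ
      (Sum.elim e (Sum.elim (fun _ : Unit => t) (Sum.elim f (fun _ : Unit => g))) :
        σ ⊕ (Unit ⊕ (σ ⊕ Unit)) → E))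
    (F : E → E)
    (hF : ∀ x, F x = ∑ b, max 0 (⟪x, e b⟫ + ⟪x, t⟫ - 1) • (-f b - g))
    (a : σ) (δ : ℝ) (hδ0 : 0 ≤ δ) (hδ : δ ≤ 1 / 4)
    (u : E) (hue : ∀ b, |⟪u, e b⟫| ≤ δ) (hut : |⟪u, t⟫| ≤ δ) :
    ‖F (e a + t + u) - (-f a - g)‖ ≤ 3 * (q : ℝ) * δ := by
  classical
  have he (b : σ) : ⟪e a, e b⟫ = if b = a then 1 else 0 := by
    simpa [eq_comm] using orthonormal_iff_ite.mp hortho (Sum.inl a) (Sum.inl b)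
  have het : ⟪e a, t⟫ = 0 := by
    simpa using orthonormal_iff_ite.mp hortho (Sum.inl a) (Sum.inr (Sum.inl ()))
  have hte (b : σ) : ⟪t, e b⟫ = 0 := by
    simpa using orthonormal_iff_ite.mp hortho (Sum.inr (Sum.inl ())) (Sum.inl b)
  have htt : ⟪t, t⟫ = 1 := by
    simpa using orthonormal_iff_ite.mp hortho (Sum.inr (Sum.inl ())) (Sum.inr (Sum.inl ()))
  have hfg (b : σ) : ‖-f b - g‖ ≤ 3 / 2 :=
    norm_neg_sub_le_of_orthogonal_unit
      (by simpa using hortho.1 (Sum.inr (Sum.inr (Sum.inl b))))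
      (by simpa using hortho.1 (Sum.inr (Sum.inr (Sum.inr ()))))
      (by simpa using
        orthonormal_iff_ite.mp hortho (.inr (.inr (.inl b))) (.inr (.inr (.inr ()))))
  have hcoeff (b : σ) :
      |max 0 (⟪e a + t + u, e b⟫ + ⟪e a + t + u, t⟫ - 1) - (if b = a then 1 else 0)|
        ≤ 2 * δ := by
    have hpre : ⟪e a + t + u, e b⟫ + ⟪e a + t + u, t⟫ - 1
        = (if b = a then 1 else 0) + ⟪u, e b⟫ + ⟪u, t⟫ := by
      simp only [inner_add_left, he, het, hte, htt]
      ring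
    rw [hpre]
    exact abs_relu_sub_le (by split_ifs <;> norm_num) (hue b) hut
  have hsplit : F (e a + t + u) - (-f a - g) =
      ∑ b, (max 0 (⟪e a + t + u, e b⟫ + ⟪e a + t + u, t⟫ - 1)
        - (if b = a then 1 else 0)) • (-f b - g) := by
    simp_rw [hF, sub_smul _ (ite _ _ _), Finset.sum_sub_distrib, ite_smul, one_smul, zero_smul]
    simp
  rw [hsplit]
  calc _ ≤ ∑ _b : σ, 2 * δ * (3 / 2) := by
        refine norm_sum_le_of_le _ fun b _ => ?_
        rw [norm_smul, Real.norm_eq_abs]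
        exact mul_le_mul (hcoeff b) (hfg b) (norm_nonneg _) (by positivity)
    _ = 3 * (q : ℝ) * δ := by
        rw [Finset.sum_const, Finset.card_univ, hq, nsmul_eq_mul]
        ring
end
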